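/- arXiv:1008.4615 — 2 statements merged into one kernel-verified Lean document; each statement's English description precedes it below -/
import Mathlib

section
/- Let C be a Young class that is not the class of all permutations. Then there exist positive integers a and d such that every permutation in C either has no increasing subsequence of length a or has no decreasing subsequence of length d; that is, C is contained in the union of the class of permutations avoiding an increasing pattern of length a and the class of permutations avoiding a decreasing pattern of length d. -/
/-- A partition: a weakly decreasing sequence of natural numbers (indexed from 0,
with missing parts treated as 0), having only finitely many nonzero parts. -/
structure YPartition where
  parts : ℕ → ℕ
  antitone : ∀ i j : ℕ, i ≤ j → parts j ≤ parts i
  finite : ∃ N : ℕ, ∀ i : ℕ, N ≤ i → parts i = 0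

/-- Partial sum of the first `r` values of `f` (so `psum lam.parts r = λ_1 + ⋯ + λ_r`). -/
def psum (f : ℕ → ℕ) (r : ℕ) : ℕ := ∑ i ∈ Finset.range r, f i

/-- The parts of the conjugate partition: `λ*_{i+1} = |{j : λ_j ≥ i+1}|` (0-indexed). -/
noncomputable def conjParts (p : YPartition) : ℕ → ℕ :=
  fun i => {j : ℕ | i + 1 ≤ p.parts j}.ncard

/-- The size `|λ| = Σ_i λ_i` of a partition. -/
noncomputable def size (p : YPartition) : ℕ := sSup (Set.range (psum p.parts))

/-- `μ` doubly dominates `lam`: each partial sum of parts of `μ` is at least the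
corresponding one for `lam`, and the same for the conjugates. -/
def DoublyDominates (μ lam : YPartition) : Prop :=
  (∀ r : ℕ, psum lam.parts r ≤ psum μ.parts r) ∧
  (∀ r : ℕ, psum (conjParts lam) r ≤ psum (conjParts μ) r)

/-- The positions in `S` form a union of `k` increasing subsequences of `π`. -/
def IsUnionKIncreasing {n : ℕ} (π : Equiv.Perm (Fin n)) (k : ℕ) (S : Finset (Fin n)) : Prop :=
  ∃ c : Fin n → Fin k, ∀ i ∈ S, ∀ j ∈ S, i < j → c i = c j → π i < π j

/-- The positions in `S` form a union of `k` decreasing subsequences of `π`. -/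
def IsUnionKDecreasing {n : ℕ} (π : Equiv.Perm (Fin n)) (k : ℕ) (S : Finset (Fin n)) : Prop :=
  ∃ c : Fin n → Fin k, ∀ i ∈ S, ∀ j ∈ S, i < j → c i = c j → π j < π i

/-- `I_k(π)`: the maximum size of a set of positions of `π` that is a union of `k`
increasing subsequences. -/
noncomputable def incMax {n : ℕ} (π : Equiv.Perm (Fin n)) (k : ℕ) : ℕ :=
  sSup {m : ℕ | ∃ S : Finset (Fin n), IsUnionKIncreasing π k S ∧ S.card = m}

/-- `D_k(π)`: the maximum size of a set of positions of `π` that is a union of `k`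
decreasing subsequences. -/
noncomputable def decMax {n : ℕ} (π : Equiv.Perm (Fin n)) (k : ℕ) : ℕ :=
  sSup {m : ℕ | ∃ S : Finset (Fin n), IsUnionKDecreasing π k S ∧ S.card = m}

/-- `σ` is involved in `π` (`σ ≼ π`): some subsequence of the values of `π` is in the
same relative order as the values of `σ`. -/
def Involved {m n : ℕ} (σ : Equiv.Perm (Fin m)) (π : Equiv.Perm (Fin n)) : Prop :=
  ∃ f : Fin m → Fin n, StrictMono f ∧ ∀ i j : Fin m, σ i < σ j ↔ π (f i) < π (f j)

/-- `π` has RSK shape `lam`, characterized via Greene's theorem: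
`λ_1 + ⋯ + λ_k = I_k(π)` and `λ*_1 + ⋯ + λ*_k = D_k(π)` for all `k`. -/
def HasShape {n : ℕ} (π : Equiv.Perm (Fin n)) (lam : YPartition) : Prop :=
  ∀ k : ℕ, psum lam.parts k = incMax π k ∧ psum (conjParts lam) k = decMax π k

/-- A permutation of arbitrary (finite) length. -/
abbrev SPerm : Type := (n : ℕ) × Equiv.Perm (Fin n)

/-- Involvement for permutations of arbitrary lengths. -/
def InvolvedS (σ π : SPerm) : Prop := Involved σ.2 π.2

/-- `π` has RSK shape `lam`. -/
def HasShapeS (π : SPerm) (lam : YPartition) : Prop := HasShape π.2 lam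

/-- A permutation class: a set of permutations downwards closed under involvement. -/
def IsPermClass (C : Set SPerm) : Prop := ∀ π ∈ C, ∀ σ : SPerm, InvolvedS σ π → σ ∈ C

/-- A Young class: a permutation class which, for each partition, contains either all
permutations of that shape or none of them. -/
def IsYoungClass (C : Set SPerm) : Prop :=
  IsPermClass C ∧ ∀ lam : YPartition,
    (∀ π : SPerm, HasShapeS π lam → π ∈ C) ∨ (∀ π : SPerm, HasShapeS π lam → π ∉ C)

/-- The Young diagram `Y`, regarded as a partition. -/
def YPartition.ofDiagram (Y : YoungDiagram) : YPartition where
  parts := Y.rowLen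
  antitone := fun _ _ h => Y.rowLen_anti _ _ h
  finite := ⟨Y.colLen 0, fun i hi => by
    by_contra h
    have h1 : (i, 0) ∈ Y := YoungDiagram.mem_iff_lt_rowLen.2 (Nat.pos_of_ne_zero h)
    have h2 := YoungDiagram.mem_iff_lt_colLen.1 h1
    omega⟩

theorem conjParts_ofDiagram (Y : YoungDiagram) :
    conjParts (YPartition.ofDiagram Y) = Y.transpose.rowLen := by
  funext i
  have : {j : ℕ | i + 1 ≤ Y.rowLen j} = ((Finset.range (Y.colLen i) : Finset ℕ) : Set ℕ) := by
    ext j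
    simp only [Set.mem_ofPred_eq, Finset.coe_range, Set.mem_Iio]
    rw [← YoungDiagram.mem_iff_lt_colLen, YoungDiagram.mem_iff_lt_rowLen]
    rfl
  simp only [conjParts, YPartition.ofDiagram, this, Set.ncard_coe_finset, Finset.card_range,
    YoungDiagram.rowLen_transpose]

/-- The points with positions `pos` and values `val` are labelled bijectively by the cells of `Y`,
in such a way that rows are increasing subsequences and columns are decreasing ones. -/
structure IsLabelling {ι α β : Type*} [LT α] [LT β] (pos : ι → α) (val : ι → β)
    (Y : YoungDiagram) (g : ι → ℕ × ℕ) : Prop where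
  injective : Function.Injective g
  mem : ∀ x, g x ∈ Y
  surj : ∀ p ∈ Y, ∃ x, g x = p
  row : ∀ x y, pos x < pos y → (g x).1 = (g y).1 → val x < val y
  col : ∀ x y, pos x < pos y → (g x).2 = (g y).2 → val y < val x

theorem card_filter_fst_lt (Y : YoungDiagram) (k : ℕ) :
    (Y.cells.filter fun p => p.1 < k).card = psum Y.rowLen k := by
  rw [psum, Finset.card_eq_sum_card_fiberwise (f := Prod.fst) (t := Finset.range k)]
  · refine Finset.sum_congr rfl fun r hr => ?_
    rw [YoungDiagram.rowLen_eq_card, YoungDiagram.row, Finset.filter_filter]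
    congr 1
    refine Finset.filter_congr fun p _ => ?_
    have := Finset.mem_range.1 hr
    constructor
    · exact fun h => h.2
    · exact fun h => ⟨by omega, h⟩
  · intro p hp
    simpa using (Finset.mem_filter.1 hp).2

/-- A labelling by the cells of `Y` with monochromatic rows and rainbow columns computes the largest
union of `k` chains. -/
theorem sSup_card_eq_psum {n : ℕ} {R : Fin n → Fin n → Prop} {Y : YoungDiagram}
    {g : Fin n → ℕ × ℕ} (hinj : Function.Injective g) (hmem : ∀ x, g x ∈ Y)
    (hsurj : ∀ p ∈ Y, ∃ x, g x = p)
    (hrow : ∀ x y, x < y → (g x).1 = (g y).1 → R x y)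
    (hcol : ∀ x y, x < y → (g x).2 = (g y).2 → ¬ R x y) (k : ℕ) :
    sSup {m : ℕ | ∃ S : Finset (Fin n),
      (∃ c : Fin n → Fin k, ∀ i ∈ S, ∀ j ∈ S, i < j → c i = c j → R i j) ∧ S.card = m} =
      psum Y.rowLen k := by
  have hub : ∀ m ∈ {m : ℕ | ∃ S : Finset (Fin n),
      (∃ c : Fin n → Fin k, ∀ i ∈ S, ∀ j ∈ S, i < j → c i = c j → R i j) ∧ S.card = m},
      m ≤ psum Y.rowLen k := by
    rintro m ⟨S, ⟨c, hc⟩, rfl⟩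
    have hmaps : ∀ x ∈ S, (g x).2 ∈ Finset.range (Y.rowLen 0) := by
      intro x _
      have h : (0, (g x).2) ∈ Y := Y.up_left_mem (Nat.zero_le _) le_rfl (hmem x)
      exact Finset.mem_range.2 (YoungDiagram.mem_iff_lt_rowLen.1 h)
    have hmaps' : ∀ p ∈ Y.cells.filter (fun p => p.1 < k), p.2 ∈ Finset.range (Y.rowLen 0) := by
      intro p hp
      have h : (0, p.2) ∈ Y := Y.up_left_mem (Nat.zero_le _) le_rfl
        (Finset.mem_filter.1 hp).1
      exact Finset.mem_range.2 (YoungDiagram.mem_iff_lt_rowLen.1 h)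
    rw [← card_filter_fst_lt, Finset.card_eq_sum_card_fiberwise hmaps,
      Finset.card_eq_sum_card_fiberwise hmaps']
    refine Finset.sum_le_sum fun j _ => ?_
    have h1 : (S.filter fun x => (g x).2 = j).card ≤ k := by
      have := Finset.card_le_card_of_injOn (s := S.filter fun x => (g x).2 = j)
        (t := (Finset.univ : Finset (Fin k))) c (fun _ _ => Finset.mem_univ _) (by
          intro x hx y hy hxy
          simp only [Finset.coe_filter, Set.mem_ofPred_eq] at hx hy
          rcases lt_trichotomy x y with h | h | h
          · exact absurd (hc x hx.1 y hy.1 h hxy) (hcol x y h (hx.2.trans hy.2.symm))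
          · exact h
          · exact absurd (hc y hy.1 x hx.1 h hxy.symm) (hcol y x h (hy.2.trans hx.2.symm)))
      simpa using this
    have h2 : (S.filter fun x => (g x).2 = j).card ≤ Y.colLen j := by
      rw [← Finset.card_range (Y.colLen j)]
      refine Finset.card_le_card_of_injOn (fun x => (g x).1) ?_ ?_
      · intro x hx
        simp only [Finset.coe_filter, Set.mem_ofPred_eq] at hx
        have := hmem x
        rw [← Prod.mk.eta (p := g x), hx.2, YoungDiagram.mem_iff_lt_colLen] at this
        simpa using this
      · intro x hx y hy hxy
        simp only [Finset.coe_filter, Set.mem_ofPred_eq] at hx hy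
        exact hinj (Prod.ext hxy (hx.2.trans hy.2.symm))
    calc _ ≤ (Finset.range (min k (Y.colLen j))).card := by simp [h1, h2]
      _ ≤ _ := by
        refine Finset.card_le_card_of_injOn (fun r => (r, j)) ?_ ?_
        · intro r hr
          simp only [Finset.coe_range, Set.mem_Iio, lt_min_iff] at hr
          simp only [Finset.coe_filter, Finset.mem_filter, Set.mem_ofPred_eq,
            YoungDiagram.mem_cells, and_true]
          exact ⟨YoungDiagram.mem_iff_lt_colLen.2 hr.2, hr.1⟩
        · intro r _ s _ h
          exact (Prod.mk.inj h).1
  refine le_antisymm (csSup_le' hub) ?_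
  rcases Nat.eq_zero_or_pos k with rfl | hk
  · simp [psum]
  refine le_csSup ⟨_, hub⟩ ⟨Finset.univ.filter fun x => (g x).1 < k,
    ⟨fun x => if h : (g x).1 < k then ⟨(g x).1, h⟩ else ⟨0, hk⟩, ?_⟩, ?_⟩
  · intro x hx y hy hxy h
    have hx := (Finset.mem_filter.1 hx).2
    have hy := (Finset.mem_filter.1 hy).2
    simp only [hx, hy, dif_pos, Fin.mk.injEq] at h
    exact hrow x y hxy h
  · rw [← card_filter_fst_lt]
    refine Finset.card_bij (fun x _ => g x) ?_ (fun _ _ _ _ h => hinj h) ?_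
    · intro x hx
      exact Finset.mem_filter.2 ⟨hmem x, (Finset.mem_filter.1 hx).2⟩
    · intro p hp
      obtain ⟨hp, hk⟩ := Finset.mem_filter.1 hp
      obtain ⟨x, rfl⟩ := hsurj p hp
      exact ⟨x, by simpa using hk, rfl⟩

theorem IsLabelling.hasShape {n : ℕ} {π : Equiv.Perm (Fin n)} {Y : YoungDiagram}
    {g : Fin n → ℕ × ℕ} (h : IsLabelling id π Y g) : HasShape π (YPartition.ofDiagram Y) := by
  intro k
  rw [conjParts_ofDiagram]
  constructor
  · exact (sSup_card_eq_psum h.injective h.mem h.surj h.row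
      (fun x y hxy e => (h.col x y hxy e).not_gt) k).symm
  · refine (sSup_card_eq_psum (g := Prod.swap ∘ g) (Prod.swap_injective.comp h.injective)
      (fun x => ?_) (fun p hp => ?_) h.col
      (fun x y hxy e => (h.row x y hxy e).not_gt) k).symm
    · simpa [YoungDiagram.mem_transpose] using h.mem x
    · obtain ⟨x, hx⟩ := h.surj p.swap (YoungDiagram.mem_transpose.1 hp)
      exact ⟨x, by simp [hx]⟩

/-- The permutation `π` is order isomorphic to the points with positions `pos` and values `val`. -/
def Realizes {ι α β : Type*} [LT α] [LT β] (π : SPerm) (pos : ι → α) (val : ι → β) : Prop :=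
  ∃ e : ι ≃ Fin π.1, (∀ x y, e x < e y ↔ pos x < pos y) ∧
    ∀ x y, π.2 (e x) < π.2 (e y) ↔ val x < val y

theorem exists_orderEquiv {ι α : Type*} [Fintype ι] [LinearOrder α] {pos : ι → α}
    (hpos : Function.Injective pos) :
    ∃ e : ι ≃ Fin (Fintype.card ι), ∀ x y, e x < e y ↔ pos x < pos y := by
  let _ : LinearOrder ι := LinearOrder.lift' pos hpos
  let e := (Fintype.orderIsoFinOfCardEq ι rfl).symm
  exact ⟨e.toEquiv, fun x y => e.lt_iff_lt⟩

theorem exists_realizes {ι α β : Type*} [Fintype ι] [LinearOrder α] [LinearOrder β] {pos : ι → α}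
    {val : ι → β} (hpos : Function.Injective pos) (hval : Function.Injective val) :
    ∃ π, Realizes π pos val := by
  obtain ⟨e, he⟩ := exists_orderEquiv hpos
  obtain ⟨f, hf⟩ := exists_orderEquiv hval
  exact ⟨⟨_, e.symm.trans f⟩, e, he, fun x y => by simpa using hf x y⟩

theorem realizes_self {n : ℕ} (π : Equiv.Perm (Fin n)) : Realizes ⟨n, π⟩ id π :=
  ⟨Equiv.refl _, fun _ _ => Iff.rfl, fun _ _ => Iff.rfl⟩

theorem Realizes.hasShape {ι α β : Type*} [LT α] [LT β] {pos : ι → α} {val : ι → β} {π : SPerm}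
    {Y : YoungDiagram} {g : ι → ℕ × ℕ} (hπ : Realizes π pos val) (h : IsLabelling pos val Y g) :
    HasShapeS π (YPartition.ofDiagram Y) := by
  obtain ⟨e, he, he'⟩ := hπ
  refine IsLabelling.hasShape (g := g ∘ e.symm) ⟨h.injective.comp e.symm.injective,
    fun x => h.mem _, fun p hp => ?_, fun x y hxy hg => ?_, fun x y hxy hg => ?_⟩
  · obtain ⟨x, rfl⟩ := h.surj p hp
    exact ⟨e x, by simp⟩
  · simpa using (he' _ _).2 (h.row (e.symm x) (e.symm y) ((he _ _).1 (by simpa using hxy)) hg)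
  · simpa using (he' _ _).2 (h.col (e.symm x) (e.symm y) ((he _ _).1 (by simpa using hxy)) hg)

theorem Realizes.involved {ι κ α β α' β' : Type*} [LT α] [LT β] [LT α'] [LT β'] {pos : ι → α}
    {val : ι → β} {pos' : κ → α'} {val' : κ → β'} {π σ : SPerm} (hπ : Realizes π pos val)
    (hσ : Realizes σ pos' val') (f : κ → ι) (hpos : ∀ x y, pos (f x) < pos (f y) ↔ pos' x < pos' y)
    (hval : ∀ x y, val (f x) < val (f y) ↔ val' x < val' y) : InvolvedS σ π := by
  obtain ⟨e, he, he'⟩ := hπ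
  obtain ⟨d, hd, hd'⟩ := hσ
  refine ⟨fun x => e (f (d.symm x)), fun x y hxy => ?_, fun x y => ?_⟩
  · rw [he, hpos, ← hd]
    simpa using hxy
  · rw [he', hval, ← hd']
    simp

/-- The class `C` contains every permutation of shape `Y`. -/
def ContainsShape (C : Set SPerm) (Y : YoungDiagram) : Prop :=
  ∀ π, HasShapeS π (YPartition.ofDiagram Y) → π ∈ C

theorem IsYoungClass.containsShape {C : Set SPerm} (hC : IsYoungClass C) {Y : YoungDiagram}
    {π : SPerm} (hπ : π ∈ C) (h : HasShapeS π (YPartition.ofDiagram Y)) : ContainsShape C Y :=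
  (hC.2 _).resolve_right fun h' => h' π h hπ

section Extension

variable {Y : YoungDiagram} {i j : ℕ}

/-- Remove the corner `(i, j)` of a Young diagram and add a cell to its first row and to its first
column. -/
def extendHook (Y : YoungDiagram) (i j : ℕ) (hi : 1 ≤ i) (hj : 1 ≤ j)
    (h1 : (i + 1, j) ∉ Y) (h2 : (i, j + 1) ∉ Y) : YoungDiagram where
  cells := insert (0, Y.rowLen 0) (insert (Y.colLen 0, 0) (Y.cells.erase (i, j)))
  isLowerSet := by
    rintro ⟨r, c⟩ ⟨r', c'⟩ ⟨hr, hc⟩ h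
    simp only [Finset.coe_insert, Finset.coe_erase, Set.mem_insert_iff, Prod.mk.injEq,
      Set.mem_sdiff, SetLike.mem_coe, YoungDiagram.mem_cells, Set.mem_singleton_iff] at *
    rcases h with h | h | ⟨h, hne⟩
    · by_cases hc' : c' = Y.rowLen 0
      · left; omega
      · refine Or.inr (Or.inr ⟨?_, by omega⟩)
        obtain rfl : r' = 0 := by omega
        exact YoungDiagram.mem_iff_lt_rowLen.2 (by omega)
    · by_cases hr' : r' = Y.colLen 0
      · right; left; omega
      · refine Or.inr (Or.inr ⟨?_, by omega⟩)
        obtain rfl : c' = 0 := by omega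
        exact YoungDiagram.mem_iff_lt_colLen.2 (by omega)
    · refine Or.inr (Or.inr ⟨Y.up_left_mem hr hc h, ?_⟩)
      rintro ⟨rfl, rfl⟩
      have : r' + 1 ≤ r ∨ c' + 1 ≤ c := by omega
      rcases this with h' | h'
      · exact h1 (Y.up_left_mem h' hc h)
      · exact h2 (Y.up_left_mem hr h' h)

theorem mem_extendHook {hi : 1 ≤ i} {hj : 1 ≤ j} {h1 : (i + 1, j) ∉ Y} {h2 : (i, j + 1) ∉ Y}
    {r c : ℕ} : (r, c) ∈ extendHook Y i j hi hj h1 h2 ↔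
      (r = 0 ∧ c = Y.rowLen 0) ∨ (r = Y.colLen 0 ∧ c = 0) ∨ (¬(r = i ∧ c = j) ∧ (r, c) ∈ Y) := by
  rw [← YoungDiagram.mem_cells]
  simp [extendHook]

/-- Positions of the cells of a Young diagram and of an additional central point `none`. -/
def hookPos (j : ℕ) : Option (ℕ × ℕ) → ℕ ×ₗ ℕ ×ₗ ℕ
  | none => toLex (0, toLex (0, j + 1))
  | some (r, c) => toLex (if c ≤ j then 0 else 1, toLex (r, c))

/-- Values of the cells of a Young diagram and of an additional central point `none`. -/
def hookVal (j : ℕ) : Option (ℕ × ℕ) → ℕ ×ₗ ℤ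
  | none => toLex (j - 1, 1)
  | some (r, c) => toLex (c, -r)

/-- The relabelling showing that adding the central point changes the shape by `extendHook`. -/
def hookLabel (a b i j : ℕ) : Option (ℕ × ℕ) → ℕ × ℕ
  | none => (0, 0)
  | some (r, c) => if r = i ∧ c = j then (0, j) else if r = 0 ∧ c = j then (b, 0) else
      if r = 0 ∧ c = 0 then (0, a) else (r, c)

theorem hookPos_lt {j r c r' c' : ℕ} :
    hookPos j (some (r, c)) < hookPos j (some (r', c')) ↔
      (c ≤ j ∧ j < c') ∨ ((c ≤ j ∨ j < c') ∧ (r < r' ∨ (r = r' ∧ c < c'))) := by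
  simp only [hookPos, Prod.Lex.toLex_lt_toLex]
  by_cases h : c ≤ j <;> by_cases h' : c' ≤ j <;> simp [h, h', not_lt] <;> omega

theorem hookPos_lt_none {j r c : ℕ} :
    hookPos j (some (r, c)) < hookPos j none ↔ r = 0 ∧ c ≤ j := by
  simp only [hookPos, Prod.Lex.toLex_lt_toLex]
  split_ifs <;> omega

theorem none_lt_hookPos {j r c : ℕ} :
    hookPos j none < hookPos j (some (r, c)) ↔ 0 < r ∨ j < c := by
  simp only [hookPos, Prod.Lex.toLex_lt_toLex]
  split_ifs <;> omega

theorem hookVal_lt {j r c r' c' : ℕ} :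
    hookVal j (some (r, c)) < hookVal j (some (r', c')) ↔ c < c' ∨ (c = c' ∧ r' < r) := by
  simp only [hookVal, Prod.Lex.toLex_lt_toLex]
  omega

theorem hookVal_lt_none {j r c : ℕ} (hj : 1 ≤ j) :
    hookVal j (some (r, c)) < hookVal j none ↔ c < j := by
  simp only [hookVal, Prod.Lex.toLex_lt_toLex]
  omega

theorem none_lt_hookVal {j r c : ℕ} (hj : 1 ≤ j) :
    hookVal j none < hookVal j (some (r, c)) ↔ j ≤ c := by
  simp only [hookVal, Prod.Lex.toLex_lt_toLex]
  omega

theorem hookPos_injective (j : ℕ) : Function.Injective (hookPos j) := by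
  intro x y h
  have h1 : ¬ hookPos j x < hookPos j y := h.not_lt
  have h2 : ¬ hookPos j y < hookPos j x := h.not_gt
  rcases x with _ | ⟨r, c⟩ <;> rcases y with _ | ⟨r', c'⟩ <;>
    simp only [hookPos_lt, hookPos_lt_none, none_lt_hookPos, reduceCtorEq, Option.some.injEq,
      Prod.mk.injEq] at * <;> omega

theorem hookVal_injective {j : ℕ} (hj : 1 ≤ j) : Function.Injective (hookVal j) := by
  intro x y h
  have h1 : ¬ hookVal j x < hookVal j y := h.not_lt
  have h2 : ¬ hookVal j y < hookVal j x := h.not_gt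
  rcases x with _ | ⟨r, c⟩ <;> rcases y with _ | ⟨r', c'⟩ <;>
    simp only [hookVal_lt, hookVal_lt_none hj, none_lt_hookVal hj, reduceCtorEq,
      Option.some.injEq, Prod.mk.injEq] at * <;> omega

theorem isLabelling_cells (Y : YoungDiagram) (j k : ℕ) :
    IsLabelling (fun p : Y.cells => hookPos j (some p.1)) (fun p => hookVal k (some p.1)) Y
      (fun p => p.1) where
  injective := Subtype.val_injective
  mem := fun p => p.2
  surj := fun p hp => ⟨⟨p, hp⟩, rfl⟩
  row := by
    rintro ⟨⟨r, c⟩, _⟩ ⟨⟨r', c'⟩, _⟩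
    simp only [hookPos_lt, hookVal_lt]
    omega
  col := by
    rintro ⟨⟨r, c⟩, _⟩ ⟨⟨r', c'⟩, _⟩
    simp only [hookPos_lt, hookVal_lt]
    omega

theorem lt_rowLen_and_lt_colLen {r c : ℕ} (h : (r, c) ∈ Y) : c < Y.rowLen 0 ∧ r < Y.colLen 0 :=
  ⟨YoungDiagram.mem_iff_lt_rowLen.1 (Y.up_left_mem (Nat.zero_le _) le_rfl h),
    YoungDiagram.mem_iff_lt_colLen.1 (Y.up_left_mem le_rfl (Nat.zero_le _) h)⟩

theorem isLabelling_extendHook (hi : 1 ≤ i) (hj : 1 ≤ j) (h1 : (i + 1, j) ∉ Y)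
    (h2 : (i, j + 1) ∉ Y) (h : (i, j) ∈ Y) :
    IsLabelling (fun p : Option Y.cells => hookPos j (p.map Subtype.val))
      (fun p => hookVal j (p.map Subtype.val)) (extendHook Y i j hi hj h1 h2)
      (fun p => hookLabel (Y.rowLen 0) (Y.colLen 0) i j (p.map Subtype.val)) := by
  have hij := lt_rowLen_and_lt_colLen h
  refine ⟨?_, ?_, ?_, ?_, ?_⟩
  · rintro (_ | ⟨⟨r, c⟩, hrc⟩) (_ | ⟨⟨r', c'⟩, hrc'⟩) <;>
      simp only [Option.map_none, Option.map_some, hookLabel, reduceCtorEq, Option.some.injEq,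
        Subtype.mk.injEq, Prod.mk.injEq]
    · simp
    · have := lt_rowLen_and_lt_colLen hrc'
      split_ifs <;> simp only [Prod.mk.injEq] <;> omega
    · have := lt_rowLen_and_lt_colLen hrc
      split_ifs <;> simp only [Prod.mk.injEq] <;> omega
    · have := lt_rowLen_and_lt_colLen hrc
      have := lt_rowLen_and_lt_colLen hrc'
      split_ifs <;> simp only [Prod.mk.injEq] <;> omega
  · rintro (_ | ⟨⟨r, c⟩, hrc⟩) <;> simp only [Option.map_none, Option.map_some, hookLabel]
    · exact mem_extendHook.2 (Or.inr (Or.inr ⟨by omega,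
        Y.up_left_mem (Nat.zero_le _) (Nat.zero_le _) h⟩))
    · split_ifs <;> rw [mem_extendHook]
      · exact Or.inr (Or.inr ⟨by omega, Y.up_left_mem (Nat.zero_le _) le_rfl h⟩)
      · simp
      · simp
      · exact Or.inr (Or.inr ⟨by omega, hrc⟩)
  · rintro ⟨r, c⟩ hrc
    rcases mem_extendHook.1 hrc with ⟨rfl, rfl⟩ | ⟨rfl, rfl⟩ | ⟨hne, hrc⟩
    · refine ⟨some ⟨(0, 0), Y.up_left_mem (Nat.zero_le _) (Nat.zero_le _) h⟩, ?_⟩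
      simp [hookLabel, (zero_lt_one.trans_le hi).ne, (zero_lt_one.trans_le hj).ne]
    · refine ⟨some ⟨(0, j), Y.up_left_mem (Nat.zero_le _) le_rfl h⟩, ?_⟩
      simp [hookLabel, (zero_lt_one.trans_le hi).ne]
    · by_cases h0 : r = 0 ∧ c = 0
      · exact ⟨none, by simp [hookLabel, h0.1, h0.2]⟩
      by_cases h0' : r = 0 ∧ c = j
      · exact ⟨some ⟨(i, j), h⟩, by simp [hookLabel, h0'.1, h0'.2]⟩
      · exact ⟨some ⟨(r, c), hrc⟩, by simp [hookLabel, h0, h0', hne]⟩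
  · rintro (_ | ⟨⟨r, c⟩, hrc⟩) (_ | ⟨⟨r', c'⟩, hrc'⟩) <;>
      simp only [Option.map_none, Option.map_some, hookLabel, hookPos_lt, hookPos_lt_none,
        none_lt_hookPos, hookVal_lt, hookVal_lt_none hj, none_lt_hookVal hj]
    · simp
    · split_ifs <;> simp only <;> omega
    · split_ifs <;> simp only <;> omega
    · have := lt_rowLen_and_lt_colLen hrc
      have := lt_rowLen_and_lt_colLen hrc'
      split_ifs <;> simp only <;> omega
  · rintro (_ | ⟨⟨r, c⟩, hrc⟩) (_ | ⟨⟨r', c'⟩, hrc'⟩) <;>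
      simp only [Option.map_none, Option.map_some, hookLabel, hookPos_lt, hookPos_lt_none,
        none_lt_hookPos, hookVal_lt, hookVal_lt_none hj, none_lt_hookVal hj]
    · simp
    · split_ifs <;> simp only <;> omega
    · split_ifs <;> simp only <;> omega
    · have := lt_rowLen_and_lt_colLen hrc
      have := lt_rowLen_and_lt_colLen hrc'
      split_ifs <;> simp only <;> omega

theorem containsShape_of_extendHook {C : Set SPerm} (hC : IsYoungClass C) (hi : 1 ≤ i) (hj : 1 ≤ j)
    (h1 : (i + 1, j) ∉ Y) (h2 : (i, j + 1) ∉ Y) (h : (i, j) ∈ Y)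
    (hY : ContainsShape C (extendHook Y i j hi hj h1 h2)) : ContainsShape C Y := by
  have hmap := Option.map_injective (Subtype.val_injective (p := (· ∈ Y.cells)))
  obtain ⟨π, hπ⟩ := exists_realizes ((hookPos_injective j).comp hmap)
    ((hookVal_injective hj).comp hmap)
  obtain ⟨σ, hσ⟩ := exists_realizes
    ((hookPos_injective j).comp (hmap.comp (Option.some_injective Y.cells)))
    ((hookVal_injective hj).comp (hmap.comp (Option.some_injective Y.cells)))
  refine hC.containsShape (hC.1 π (hY π (hπ.hasShape (isLabelling_extendHook hi hj h1 h2 h))) σ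
    (hπ.involved hσ some (fun _ _ => Iff.rfl) fun _ _ => Iff.rfl))
    (hσ.hasShape (isLabelling_cells Y j j))

end Extension

theorem involved_of_chains {π : SPerm} {S T : Finset (Fin π.1)} {x : Fin π.1}
    (hS : ∀ i ∈ S, ∀ j ∈ S, i < j → π.2 i < π.2 j) (hT : ∀ i ∈ T, ∀ j ∈ T, i < j → π.2 j < π.2 i)
    (hxS : x ∈ S) (hxT : x ∈ T) {Y : YoungDiagram} (hY : ∀ r c, (r, c) ∈ Y → r = 0 ∨ c = 0)
    (hrow : Y.rowLen 0 ≤ S.card) (hcol : Y.colLen 0 ≤ T.card) :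
    ∃ σ, InvolvedS σ π ∧ HasShapeS σ (YPartition.ofDiagram Y) := by
  have key : ∀ U : Finset (Fin π.1), x ∈ U → ∃ φ : ℕ → Fin π.1, φ 0 = x ∧ (∀ c, φ c ∈ U) ∧
      Set.InjOn φ (Set.Iio U.card) := by
    intro U hx
    have hcard := Finset.card_erase_add_one hx
    let e := (U.erase x).equivFin.symm
    refine ⟨fun c => match c with
      | 0 => x
      | c + 1 => if h : c < (U.erase x).card then (e ⟨c, h⟩).1 else x, rfl, ?_, ?_⟩
    · rintro (_ | c)
      · exact hx
      · dsimp only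
        split_ifs with h
        · exact Finset.mem_of_mem_erase (e ⟨c, h⟩).2
        · exact hx
    · rintro (_ | c) hc (_ | d) hd h <;> dsimp only at h
      · rfl
      · simp only [Set.mem_Iio] at hd
        rw [dif_pos (by omega)] at h
        exact absurd h.symm (Finset.ne_of_mem_erase (e _).2)
      · simp only [Set.mem_Iio] at hc
        rw [dif_pos (by omega)] at h
        exact absurd h (Finset.ne_of_mem_erase (e _).2)
      · simp only [Set.mem_Iio] at hc hd
        rw [dif_pos (by omega), dif_pos (by omega)] at h
        have := e.injective (Subtype.ext h)
        simpa using this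
  obtain ⟨φ, hφ0, hφ, hφi⟩ := key S hxS
  obtain ⟨ψ, hψ0, hψ, hψi⟩ := key T hxT
  have hST : ∀ y ∈ S, y ∈ T → y = x := by
    intro y hy hy'
    rcases lt_trichotomy y x with h | h | h
    · exact absurd (hS y hy x hxS h) (hT y hy' x hxT h).not_gt
    · exact h
    · exact absurd (hS x hxS y hy h) (hT x hxT y hy' h).not_gt
  let q : Y.cells → Fin π.1 := fun p => if p.1.1 = 0 then φ p.1.2 else ψ p.1.1
  have q_row : ∀ p : Y.cells, p.1.1 = 0 → q p = φ p.1.2 := fun p hp => if_pos hp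
  have q_col : ∀ p : Y.cells, p.1.2 = 0 → q p = ψ p.1.1 := by
    intro p hp
    by_cases h : p.1.1 = 0
    · rw [q_row p h, hp, h, hφ0, hψ0]
    · exact if_neg h
  have hlen : ∀ p : Y.cells, p.1.2 < S.card ∧ p.1.1 < T.card := fun p =>
    have := lt_rowLen_and_lt_colLen p.2
    ⟨this.1.trans_le hrow, this.2.trans_le hcol⟩
  have h0S : 0 < S.card := Finset.card_pos.2 ⟨x, hxS⟩
  have h0T : 0 < T.card := Finset.card_pos.2 ⟨x, hxT⟩
  have cross : ∀ p p' : Y.cells, p.1.1 = 0 → p'.1.2 = 0 → q p = q p' → p = p' := by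
    intro p p' hp hp' h
    rw [q_row p hp, q_col p' hp'] at h
    have h1 := hST _ (hφ p.1.2) (h ▸ hψ _)
    have h2 : p.1.2 = 0 := hφi (hlen p).1 h0S (h1.trans hφ0.symm)
    have h3 : p'.1.1 = 0 := hψi (hlen p').2 h0T ((h.symm.trans h1).trans hψ0.symm)
    exact Subtype.ext (Prod.ext (hp.trans h3.symm) (h2.trans hp'.symm))
  have hq : Function.Injective q := by
    intro p p' h
    rcases hY p.1.1 p.1.2 p.2 with hp | hp <;> rcases hY p'.1.1 p'.1.2 p'.2 with hp' | hp'
    · rw [q_row p hp, q_row p' hp'] at h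
      exact Subtype.ext (Prod.ext (hp.trans hp'.symm) (hφi (hlen p).1 (hlen p').1 h))
    · exact cross p p' hp hp' h
    · exact (cross p' p hp' hp h.symm).symm
    · rw [q_col p hp, q_col p' hp'] at h
      exact Subtype.ext (Prod.ext (hψi (hlen p).2 (hlen p').2 h) (hp.trans hp'.symm))
  obtain ⟨σ, hσ⟩ := exists_realizes hq (π.2.injective.comp hq)
  refine ⟨σ, (realizes_self π.2).involved hσ q (fun _ _ => Iff.rfl) (fun _ _ => Iff.rfl),
    hσ.hasShape (g := Subtype.val) ⟨Subtype.val_injective, fun p => p.2,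
      fun p hp => ⟨⟨p, hp⟩, rfl⟩, fun p p' h e => ?_, fun p p' h e => ?_⟩⟩
  · by_cases hp : p.1.1 = 0
    · have hp' := e.symm.trans hp
      have h1 := q_row p hp
      have h2 := q_row p' hp'
      exact hS _ (h1 ▸ hφ _) _ (h2 ▸ hφ _) h
    · have h1 := (hY _ _ p.2).resolve_left hp
      have h2 := (hY _ _ p'.2).resolve_left (fun h' => hp (e.trans h'))
      rw [Subtype.ext (Prod.ext e (h1.trans h2.symm)) (a1 := p) (a2 := p')] at h
      exact absurd h (lt_irrefl _)
  · by_cases hp : p.1.2 = 0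
    · have hp' := e.symm.trans hp
      have h1 := q_col p hp
      have h2 := q_col p' hp'
      exact hT _ (h1 ▸ hψ _) _ (h2 ▸ hψ _) h
    · have h1 := (hY _ _ p.2).resolve_right hp
      have h2 := (hY _ _ p'.2).resolve_right (fun h' => hp (e.trans h'))
      rw [Subtype.ext (Prod.ext (h1.trans h2.symm) e) (a1 := p) (a2 := p')] at h
      exact absurd h (lt_irrefl _)

/-- Long increasing and decreasing subsequences can be thinned out so that they cross. -/
theorem exists_crossing_chains {n : ℕ} (π : Equiv.Perm (Fin n)) {S T : Finset (Fin n)} {a d : ℕ}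
    (hS : ∀ i ∈ S, ∀ j ∈ S, i < j → π i < π j) (hT : ∀ i ∈ T, ∀ j ∈ T, i < j → π j < π i)
    (ha : 0 < a) (hd : 0 < d) (hSa : 2 * a ≤ S.card) (hTd : 2 * d ≤ T.card) :
    ∃ S' T' : Finset (Fin n), ∃ x ∈ S', x ∈ T' ∧ (∀ i ∈ S', ∀ j ∈ S', i < j → π i < π j) ∧
      (∀ i ∈ T', ∀ j ∈ T', i < j → π j < π i) ∧ a ≤ S'.card ∧ d ≤ T'.card := by
  let dec : Fin n → Fin n → Prop := fun x y => (x < y → π y < π x) ∧ (y < x → π x < π y)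
  let inc : Fin n → Fin n → Prop := fun x y => (x < y → π x < π y) ∧ (y < x → π y < π x)
  classical
  have inc_of_not_dec : ∀ x y, ¬ dec x y → inc x y := by
    intro x y h
    rcases lt_trichotomy x y with hxy | rfl | hxy
    · refine ⟨fun _ => ?_, fun h' => absurd h' hxy.not_gt⟩
      by_contra h'
      exact h ⟨fun _ => lt_of_le_of_ne (not_lt.1 h') (π.injective.ne hxy.ne'),
        fun h' => absurd h' hxy.not_gt⟩
    · exact absurd ⟨fun h => absurd h (lt_irrefl _), fun h => absurd h (lt_irrefl _)⟩ h
    · refine ⟨fun h' => absurd h' hxy.not_gt, fun _ => ?_⟩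
      by_contra h'
      exact h ⟨fun h' => absurd h' hxy.not_gt,
        fun _ => lt_of_le_of_ne (not_lt.1 h') (π.injective.ne hxy.ne')⟩
  by_cases h1 : ∃ x ∈ S, d ≤ (T.filter (dec x)).card
  · obtain ⟨x, hx, hcard⟩ := h1
    refine ⟨S, insert x (T.filter (dec x)), x, hx, Finset.mem_insert_self _ _, hS, ?_, by omega,
      hcard.trans (Finset.card_le_card (Finset.subset_insert _ _))⟩
    intro i hi j hj hij
    rcases Finset.mem_insert.1 hi with rfl | hi <;> rcases Finset.mem_insert.1 hj with rfl | hj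
    · exact absurd hij (lt_irrefl _)
    · exact (Finset.mem_filter.1 hj).2.1 hij
    · exact (Finset.mem_filter.1 hi).2.2 hij
    · exact hT i (Finset.mem_filter.1 hi).1 j (Finset.mem_filter.1 hj).1 hij
  by_cases h2 : ∃ y ∈ T, a ≤ (S.filter fun x => inc x y).card
  · obtain ⟨y, hy, hcard⟩ := h2
    refine ⟨insert y (S.filter fun x => inc x y), T, y, Finset.mem_insert_self _ _, hy, ?_, hT,
      hcard.trans (Finset.card_le_card (Finset.subset_insert _ _)), by omega⟩
    intro i hi j hj hij
    rcases Finset.mem_insert.1 hi with rfl | hi <;> rcases Finset.mem_insert.1 hj with rfl | hj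
    · exact absurd hij (lt_irrefl _)
    · exact (Finset.mem_filter.1 hj).2.2 hij
    · exact (Finset.mem_filter.1 hi).2.1 hij
    · exact hS i (Finset.mem_filter.1 hi).1 j (Finset.mem_filter.1 hj).1 hij
  exfalso
  push Not at h1 h2
  have e1 : ∑ x ∈ S, (T.filter (dec x)).card ≤ S.card * (d - 1) := by
    rw [← smul_eq_mul]
    exact Finset.sum_le_card_nsmul _ _ _ fun x hx => Nat.le_sub_one_of_lt (h1 x hx)
  have e2 : ∑ y ∈ T, (S.filter fun x => inc x y).card ≤ T.card * (a - 1) := by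
    rw [← smul_eq_mul]
    exact Finset.sum_le_card_nsmul _ _ _ fun x hx => Nat.le_sub_one_of_lt (h2 x hx)
  have e3 : ∑ y ∈ T, (S.filter fun x => inc x y).card = ∑ x ∈ S, (T.filter (inc x)).card :=
    (Finset.sum_card_bipartiteAbove_eq_sum_card_bipartiteBelow inc).symm
  have e4 : S.card * T.card ≤ ∑ x ∈ S, ((T.filter (dec x)).card + (T.filter (inc x)).card) := by
    rw [← smul_eq_mul]
    refine Finset.card_nsmul_le_sum _ _ _ fun x _ => ?_
    rw [← Finset.card_filter_add_card_filter_not (s := T) (dec x)]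
    exact Nat.add_le_add_left (Finset.card_le_card
      (Finset.monotone_filter_right _ fun y _ => inc_of_not_dec x y)) _
  rw [Finset.sum_add_distrib, ← e3] at e4
  obtain ⟨a, rfl⟩ := Nat.exists_eq_succ_of_ne_zero ha.ne'
  obtain ⟨d, rfl⟩ := Nat.exists_eq_succ_of_ne_zero hd.ne'
  simp only [Nat.succ_eq_add_one, Nat.add_sub_cancel] at *
  nlinarith

theorem exists_card_eq_sSup {n : ℕ} (P : Finset (Fin n) → Prop) (h : P ∅) :
    ∃ S, P S ∧ S.card = sSup {m : ℕ | ∃ S : Finset (Fin n), P S ∧ S.card = m} :=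
  Nat.sSup_mem (s := {m : ℕ | ∃ S : Finset (Fin n), P S ∧ S.card = m}) ⟨0, ∅, h, rfl⟩
    ⟨n, fun m ⟨S, _, hm⟩ => hm ▸ (by simpa using S.card_le_univ)⟩

theorem exists_increasing {n : ℕ} (π : Equiv.Perm (Fin n)) :
    ∃ S : Finset (Fin n), (∀ i ∈ S, ∀ j ∈ S, i < j → π i < π j) ∧ S.card = incMax π 1 := by
  obtain ⟨S, ⟨c, hc⟩, h⟩ := exists_card_eq_sSup (IsUnionKIncreasing π 1) ⟨fun _ => 0, by simp⟩
  exact ⟨S, fun i hi j hj hij => hc i hi j hj hij (Subsingleton.elim _ _), h⟩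

theorem exists_decreasing {n : ℕ} (π : Equiv.Perm (Fin n)) :
    ∃ S : Finset (Fin n), (∀ i ∈ S, ∀ j ∈ S, i < j → π j < π i) ∧ S.card = decMax π 1 := by
  obtain ⟨S, ⟨c, hc⟩, h⟩ := exists_card_eq_sSup (IsUnionKDecreasing π 1) ⟨fun _ => 0, by simp⟩
  exact ⟨S, fun i hi j hj hij => hc i hi j hj hij (Subsingleton.elim _ _), h⟩

/-- A Young class that contains permutations with arbitrarily long increasing and decreasing
subsequences contains all shapes. -/
theorem IsYoungClass.containsShape_of_unbounded {C : Set SPerm} (hC : IsYoungClass C)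
    (h : ∀ a d : ℕ, 0 < a → 0 < d → ∃ π ∈ C, a ≤ incMax π.2 1 ∧ d ≤ decMax π.2 1)
    (Y : YoungDiagram) : ContainsShape C Y := by
  induction hm : (Y.cells.filter fun p => 1 ≤ p.1 ∧ 1 ≤ p.2).card generalizing Y with
  | zero =>
    have hY : ∀ r c, (r, c) ∈ Y → r = 0 ∨ c = 0 := by
      intro r c hrc
      by_contra h'
      have : (r, c) ∈ Y.cells.filter fun p => 1 ≤ p.1 ∧ 1 ≤ p.2 :=
        Finset.mem_filter.2 ⟨hrc, by dsimp only; omega⟩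
      simp [Finset.card_eq_zero.1 hm] at this
    obtain ⟨π, hπ, ha, hd⟩ := h (2 * (Y.rowLen 0 + 1)) (2 * (Y.colLen 0 + 1)) (by omega) (by omega)
    obtain ⟨S, hS, hSc⟩ := exists_increasing π.2
    obtain ⟨T, hT, hTc⟩ := exists_decreasing π.2
    obtain ⟨S', T', x, hxS, hxT, hS', hT', ha', hd'⟩ := exists_crossing_chains π.2 hS hT
      (Nat.succ_pos _) (Nat.succ_pos _) (ha.trans hSc.ge) (hd.trans hTc.ge)
    obtain ⟨σ, hσ, hσY⟩ := involved_of_chains hS' hT' hxS hxT hY (by omega) (by omega)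
    exact hC.containsShape (hC.1 π hπ σ hσ) hσY
  | succ m ih =>
    obtain ⟨⟨i, j⟩, hij, hmax⟩ := Finset.exists_max_image
      (Y.cells.filter fun p => 1 ≤ p.1 ∧ 1 ≤ p.2) (fun p => p.1 + p.2)
      (Finset.card_pos.1 (by omega))
    obtain ⟨hY, hi, hj⟩ := Finset.mem_filter.1 hij
    have h1 : (i + 1, j) ∉ Y := fun h' => by
      have := hmax (i + 1, j) (Finset.mem_filter.2 ⟨h', by dsimp only at *; omega⟩)
      dsimp only at this
      omega
    have h2 : (i, j + 1) ∉ Y := fun h' => by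
      have := hmax (i, j + 1) (Finset.mem_filter.2 ⟨h', by dsimp only at *; omega⟩)
      dsimp only at this
      omega
    refine containsShape_of_extendHook hC hi hj h1 h2 hY (ih _ ?_)
    have : ((extendHook Y i j hi hj h1 h2).cells.filter fun p => 1 ≤ p.1 ∧ 1 ≤ p.2) =
        (Y.cells.filter fun p => 1 ≤ p.1 ∧ 1 ≤ p.2).erase (i, j) := by
      ext ⟨r, c⟩
      simp only [Finset.mem_filter, Finset.mem_erase, YoungDiagram.mem_cells, mem_extendHook, ne_eq,
        Prod.mk.injEq]
      constructor
      · rintro ⟨h' | h' | h', h''⟩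
        · omega
        · omega
        · exact ⟨h'.1, h'.2, h''⟩
      · rintro ⟨h', h'', h'''⟩
        exact ⟨Or.inr (Or.inr ⟨h', h''⟩), h'''⟩
    rw [this, Finset.card_erase_of_mem hij, hm, Nat.add_sub_cancel]

/-- The square Young diagram of side `n`. -/
def squareDiagram (n : ℕ) : YoungDiagram where
  cells := Finset.range n ×ˢ Finset.range n
  isLowerSet := by
    rintro ⟨r, c⟩ ⟨r', c'⟩ ⟨hr, hc⟩ h
    simp only [Finset.coe_product, Finset.coe_range, Set.mem_prod, Set.mem_Iio] at *
    omega

theorem mem_of_containsShape_squareDiagram {C : Set SPerm} (hC : IsPermClass C) (π : SPerm)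
    (h : ContainsShape C (squareDiagram π.1)) : π ∈ C := by
  have hmem : ∀ r c : Fin π.1, ((r : ℕ), (c : ℕ)) ∈ (squareDiagram π.1).cells := by
    simp [squareDiagram]
  have hinj := (Option.some_injective (ℕ × ℕ)).comp
    (Subtype.val_injective (p := (· ∈ (squareDiagram π.1).cells)))
  obtain ⟨τ, hτ⟩ := exists_realizes ((hookPos_injective π.1).comp hinj)
    ((hookVal_injective (j := π.1 + 1) (by omega)).comp hinj)
  refine hC τ (h τ (hτ.hasShape (isLabelling_cells _ _ _))) π
    (hτ.involved (realizes_self π.2) (fun x => ⟨_, hmem x (π.2 x)⟩) (fun x y => ?_) fun x y => ?_)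
  · simp only [Function.comp_apply, hookPos_lt, id_eq, Fin.lt_def]
    have hxy : (x : ℕ) = y → π.2 x = π.2 y := fun e => congrArg _ (Fin.ext e)
    have := (π.2 x).2
    have := (π.2 y).2
    rw [Fin.ext_iff] at hxy
    omega
  · simp only [Function.comp_apply, hookVal_lt, Fin.lt_def]
    have hxy : (π.2 x : ℕ) = π.2 y → x = y := fun e => π.2.injective (Fin.ext e)
    rw [Fin.ext_iff] at hxy
    omega

theorem proper_young_class_avoids_monotone (C : Set SPerm)
    (hC : IsYoungClass C) (hne : C ≠ Set.univ) :
    ∃ a d : ℕ, 0 < a ∧ 0 < d ∧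
      ∀ π ∈ C, incMax π.2 1 < a ∨ decMax π.2 1 < d := by
  by_contra! h
  exact hne (Set.eq_univ_of_forall fun π => mem_of_containsShape_squareDiagram hC.1 π
    (hC.containsShape_of_unbounded h _))
end

section
/- Let C be a Young class that is not the class of all permutations. Then there is a constant k such that no permutation in C contains both an increasing subsequence of length k and a decreasing subsequence of length k. -/
/-- The cells `(i, j)` (row `i`, column `j`) of the Young diagram of a partition. -/
abbrev Cell (lam : YPartition) : Type := {c : ℕ × ℕ // c.2 < lam.parts c.1}

instance (lam : YPartition) : Finite (Cell lam) := by
  obtain ⟨N, hN⟩ := lam.finite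
  refine Set.Finite.subset (Finset.range N ×ˢ Finset.range (lam.parts 0)).finite_toSet ?_
  rintro ⟨i, j⟩ (h : j < lam.parts i)
  have h0 := lam.antitone 0 i (Nat.zero_le i)
  have hi : i < N := by
    by_contra! hi
    have := hN i hi
    omega
  simp only [Finset.coe_product, Finset.coe_range, Set.mem_prod, Set.mem_Iio]
  omega

/-- Two keys (a position and a value) on the cells of a diagram, for which the rows are
increasing and the columns are decreasing. -/
structure IsFilling {P V : Type*} [LT P] [LT V] (lam : YPartition)
    (p : Cell lam → P) (v : Cell lam → V) : Prop where
  row : ∀ c d : Cell lam, c.1.1 = d.1.1 → (p c < p d ↔ v c < v d)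
  col : ∀ c d : Cell lam, c.1.2 = d.1.2 → (p c < p d ↔ v d < v c)

/-! ### Permutations with a filling have the corresponding shape -/

theorem card_filter_lt_eq_psum {n : ℕ} (row : Fin n → ℕ) (f : ℕ → ℕ)
    (hf : ∀ i, (Finset.univ.filter fun x => row x = i).card = f i) (r : ℕ) :
    (Finset.univ.filter fun x => row x < r).card = psum f r := by
  rw [psum, Finset.card_eq_sum_card_fiberwise (f := row) (t := Finset.range r)]
  · refine Finset.sum_congr rfl fun i hi => ?_
    rw [← hf i, Finset.filter_filter]
    congr 1
    ext x
    simp only [Finset.mem_range] at hi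
    simp only [Finset.mem_filter, Finset.mem_univ, true_and]
    omega
  · intro x hx
    simpa using hx

/-- If every column is an initial segment of rows, a set meeting each column in at most `r`
points is no larger than the union of the first `r` rows. -/
theorem card_le_card_filter_row_lt {n r : ℕ} (row col : Fin n → ℕ)
    (hdown : ∀ x i, i < row x → ∃ y, col y = col x ∧ row y = i)
    (S : Finset (Fin n)) (c : Fin n → Fin r)
    (hc : ∀ x ∈ S, ∀ y ∈ S, col x = col y → c x = c y → x = y) :
    S.card ≤ (Finset.univ.filter fun x => row x < r).card := by
  rw [Finset.card_eq_sum_card_fiberwise (f := col) (t := Finset.univ.image col) (s := S)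
      (fun x _ => by simp),
    Finset.card_eq_sum_card_fiberwise (f := col) (t := Finset.univ.image col)
      (s := Finset.univ.filter fun x => row x < r) (fun x _ => by simp)]
  refine Finset.sum_le_sum fun j _ => ?_
  by_cases h : ∃ x, col x = j ∧ r ≤ row x
  · obtain ⟨x, rfl, hx⟩ := h
    calc (S.filter fun y => col y = col x).card
        ≤ (Finset.univ : Finset (Fin r)).card := by
          refine Finset.card_le_card_of_injOn c (fun _ _ => by simp) ?_
          intro y hy z hz hyz
          simp only [Finset.coe_filter, Set.mem_ofPred_eq] at hy hz
          exact hc y hy.1 z hz.1 (hy.2.trans hz.2.symm) hyz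
      _ = (Finset.range r).card := by simp
      _ ≤ _ := by
          refine Finset.card_le_card_of_surjOn row ?_
          intro i hi
          simp only [Finset.coe_range, Set.mem_Iio] at hi
          obtain ⟨y, hy, hyi⟩ := hdown x i (by omega)
          refine ⟨y, ?_, hyi⟩
          simp only [Finset.coe_filter, Finset.mem_filter, Finset.mem_univ, true_and,
            Set.mem_ofPred_eq]
          exact ⟨by omega, hy⟩
  · push Not at h
    refine Finset.card_le_card fun y hy => ?_
    simp only [Finset.mem_filter, Finset.mem_univ, true_and] at hy ⊢
    exact ⟨h y hy.2, hy.2⟩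

theorem nat_sSup_eq_of_mem_upperBounds {s : Set ℕ} {a : ℕ} (hub : a ∈ upperBounds s)
    (h : a = 0 ∨ a ∈ s) : sSup s = a :=
  le_antisymm (csSup_le' hub) <| by
    rcases h with rfl | h
    · exact Nat.zero_le _
    · exact le_csSup ⟨a, hub⟩ h

theorem hasShape_of_isFilling {n : ℕ} (π : Equiv.Perm (Fin n)) (lam : YPartition)
    (e : Fin n ≃ Cell lam) (h : IsFilling lam e.symm (fun c => π (e.symm c))) :
    HasShape π lam := by
  have hrow : ∀ x y, (e x).1.1 = (e y).1.1 → x < y → π x < π y := fun x y hxy hlt => by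
    have := h.row (e x) (e y) hxy
    simp only [Equiv.symm_apply_apply] at this
    exact this.1 hlt
  have hcol : ∀ x y, (e x).1.2 = (e y).1.2 → x < y → π y < π x := fun x y hxy hlt => by
    have := h.col (e x) (e y) hxy
    simp only [Equiv.symm_apply_apply] at this
    exact this.1 hlt
  have crow : ∀ i, (Finset.univ.filter fun x => (e x).1.1 = i).card = lam.parts i := by
    intro i
    rw [← Finset.card_range (lam.parts i)]
    refine Finset.card_bij (fun x _ => (e x).1.2) ?_ ?_ ?_
    · intro x hx
      simp only [Finset.mem_filter, Finset.mem_univ, true_and] at hx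
      have := (e x).2
      rw [hx] at this
      simpa using this
    · intro x hx y hy hxy
      simp only [Finset.mem_filter, Finset.mem_univ, true_and] at hx hy
      exact e.injective (Subtype.ext (Prod.ext (hx.trans hy.symm) hxy))
    · intro j hj
      exact ⟨e.symm ⟨(i, j), by simpa using hj⟩, by simp, by simp⟩
  have ccol : ∀ j, (Finset.univ.filter fun x => (e x).1.2 = j).card = conjParts lam j := by
    intro j
    rw [conjParts, ← Set.ncard_coe_finset]
    refine Set.ncard_congr (fun x _ => (e x).1.1) ?_ ?_ ?_
    · intro x hx
      simp only [Finset.coe_filter, Finset.mem_univ, true_and, Set.mem_ofPred_eq] at hx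
      have := (e x).2
      rw [hx] at this
      exact this
    · intro x y hx hy hxy
      simp only [Finset.coe_filter, Finset.mem_univ, true_and, Set.mem_ofPred_eq] at hx hy
      exact e.injective (Subtype.ext (Prod.ext hxy (hx.trans hy.symm)))
    · intro i hi
      exact ⟨e.symm ⟨(i, j), hi⟩, by simp, by simp⟩
  intro k
  rw [← card_filter_lt_eq_psum _ _ crow, ← card_filter_lt_eq_psum _ _ ccol]
  constructor
  · refine (nat_sSup_eq_of_mem_upperBounds ?_ ?_).symm
    · rintro m ⟨S, ⟨c, hc⟩, rfl⟩
      refine card_le_card_filter_row_lt _ (fun x => (e x).1.2) ?_ S c ?_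
      · intro x i hi
        exact ⟨e.symm ⟨(i, (e x).1.2), (e x).2.trans_le (lam.antitone _ _ hi.le)⟩,
          by simp, by simp⟩
      · intro x hx y hy hxy hcxy
        rcases lt_trichotomy x y with hlt | heq | hlt
        · exact absurd (hc x hx y hy hlt hcxy) (hcol x y hxy hlt).asymm
        · exact heq
        · exact absurd (hc y hy x hx hlt hcxy.symm) (hcol y x hxy.symm hlt).asymm
    · rcases k.eq_zero_or_pos with rfl | hk
      · simp
      · refine Or.inr ⟨_, ⟨fun x => ⟨(e x).1.1 % k, Nat.mod_lt _ hk⟩, ?_⟩, rfl⟩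
        intro x hx y hy hlt hxy
        simp only [Finset.mem_filter, Finset.mem_univ, true_and] at hx hy
        simp only [Fin.mk.injEq, Nat.mod_eq_of_lt hx, Nat.mod_eq_of_lt hy] at hxy
        exact hrow x y hxy hlt
  · refine (nat_sSup_eq_of_mem_upperBounds ?_ ?_).symm
    · rintro m ⟨S, ⟨c, hc⟩, rfl⟩
      refine card_le_card_filter_row_lt _ (fun x => (e x).1.1) ?_ S c ?_
      · intro x i hi
        exact ⟨e.symm ⟨((e x).1.1, i), hi.trans (e x).2⟩, by simp, by simp⟩
      · intro x hx y hy hxy hcxy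
        rcases lt_trichotomy x y with hlt | heq | hlt
        · exact absurd (hc x hx y hy hlt hcxy) (hrow x y hxy hlt).asymm
        · exact heq
        · exact absurd (hc y hy x hx hlt hcxy.symm) (hrow y x hxy.symm hlt).asymm
    · rcases k.eq_zero_or_pos with rfl | hk
      · simp
      · refine Or.inr ⟨_, ⟨fun x => ⟨(e x).1.2 % k, Nat.mod_lt _ hk⟩, ?_⟩, rfl⟩
        intro x hx y hy hlt hxy
        simp only [Finset.mem_filter, Finset.mem_univ, true_and] at hx hy
        simp only [Fin.mk.injEq, Nat.mod_eq_of_lt hx, Nat.mod_eq_of_lt hy] at hxy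
        exact hcol x y hxy hlt

/-! ### Permutations realizing a pair of keys -/

theorem exists_equiv_lt_iff {α P : Type*} [Fintype α] [LinearOrder P] (p : α → P)
    (hp : Function.Injective p) :
    ∃ e : Fin (Fintype.card α) ≃ α, ∀ x y, x < y ↔ p (e x) < p (e y) := by
  let _ := LinearOrder.lift' p hp
  exact ⟨(monoEquivOfFin α rfl).toEquiv, fun x y => (monoEquivOfFin α rfl).lt_iff_lt.symm⟩

theorem exists_perm_lt_iff {α P V : Type*} [Finite α] [LinearOrder P] [LinearOrder V]
    (p : α → P) (v : α → V) (hp : Function.Injective p) (hv : Function.Injective v) :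
    ∃ (n : ℕ) (π : Equiv.Perm (Fin n)) (e : Fin n ≃ α),
      (∀ x y, x < y ↔ p (e x) < p (e y)) ∧ (∀ x y, π x < π y ↔ v (e x) < v (e y)) := by
  have := Fintype.ofFinite α
  obtain ⟨e, he⟩ := exists_equiv_lt_iff p hp
  obtain ⟨e', he'⟩ := exists_equiv_lt_iff v hv
  exact ⟨_, e.trans e'.symm, e, he, fun x y => by simp [he']⟩

theorem IsFilling.exists_perm {P V : Type*} [LinearOrder P] [LinearOrder V] {lam : YPartition}
    {p : Cell lam → P} {v : Cell lam → V} (h : IsFilling lam p v)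
    (hp : Function.Injective p) (hv : Function.Injective v) :
    ∃ (n : ℕ) (π : Equiv.Perm (Fin n)) (e : Fin n ≃ Cell lam), HasShape π lam ∧
      (∀ x y, x < y ↔ p (e x) < p (e y)) ∧ (∀ x y, π x < π y ↔ v (e x) < v (e y)) := by
  obtain ⟨n, π, e, he, hπ⟩ := exists_perm_lt_iff p v hp hv
  refine ⟨n, π, e, hasShape_of_isFilling π lam e ⟨fun c d hcd => ?_, fun c d hcd => ?_⟩, he, hπ⟩
  · exact (he _ _).trans (Iff.trans (by simpa using h.row c d hcd) (hπ _ _).symm)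
  · exact (he _ _).trans (Iff.trans (by simpa using h.col c d hcd) (hπ _ _).symm)

/-! ### Shapes belonging to a Young class -/

/-- The partitions all of whose permutations belong to `C`. -/
def shapesOf (C : Set SPerm) : Set YPartition :=
  {lam | ∀ π : SPerm, HasShapeS π lam → π ∈ C}

theorem mem_shapesOf_of_mem {C : Set SPerm} (hC : IsYoungClass C) {n : ℕ}
    {π : Equiv.Perm (Fin n)} (hπ : (⟨n, π⟩ : SPerm) ∈ C) {lam : YPartition}
    (g : Cell lam → Fin n) (hg : Function.Injective g)
    (h : IsFilling lam g (fun c => π (g c))) : lam ∈ shapesOf C := by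
  obtain ⟨m, σ, e, hσ, he, hv⟩ := h.exists_perm hg (π.injective.comp hg)
  have hmem : (⟨m, σ⟩ : SPerm) ∈ C :=
    hC.1 _ hπ ⟨m, σ⟩ ⟨fun x => g (e x), fun x y hxy => (he x y).1 hxy, hv⟩
  exact (hC.2 lam).resolve_right fun hno => hno ⟨m, σ⟩ hσ hmem

theorem mem_of_mem_shapesOf {C : Set SPerm} (hC : IsPermClass C) {P V : Type*} [LinearOrder P]
    [LinearOrder V] {lam : YPartition} (hlam : lam ∈ shapesOf C)
    {p : Cell lam → P} {v : Cell lam → V} (h : IsFilling lam p v)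
    (hp : Function.Injective p) (hv : Function.Injective v) {m : ℕ} (σ : Equiv.Perm (Fin m))
    (f : Fin m → Cell lam) (hf : ∀ x y, x < y → p (f x) < p (f y))
    (hσ : ∀ x y, σ x < σ y ↔ v (f x) < v (f y)) : (⟨m, σ⟩ : SPerm) ∈ C := by
  obtain ⟨n, π, e, hπ, hpe, hve⟩ := h.exists_perm hp hv
  refine hC ⟨n, π⟩ (hlam ⟨n, π⟩ hπ) ⟨m, σ⟩ ⟨fun x => e.symm (f x), fun x y hxy => ?_, ?_⟩
  · simpa [hpe] using hf x y hxy
  · simpa [hve] using hσ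

theorem mem_shapesOf_of_mem_shapesOf {C : Set SPerm} (hC : IsYoungClass C) {P V : Type*}
    [LinearOrder P] [LinearOrder V] {lam mu : YPartition} (hlam : lam ∈ shapesOf C)
    {p : Cell lam → P} {v : Cell lam → V} (h : IsFilling lam p v)
    (hp : Function.Injective p) (hv : Function.Injective v)
    (g : Cell mu → Cell lam) (hg : Function.Injective g)
    (hmu : IsFilling mu (fun c => p (g c)) (fun c => v (g c))) : mu ∈ shapesOf C := by
  obtain ⟨n, π, e, hπ, hpe, hve⟩ := h.exists_perm hp hv
  refine mem_shapesOf_of_mem hC (hlam ⟨n, π⟩ hπ) (fun c => e.symm (g c))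
    (e.symm.injective.comp hg) ⟨fun c d hcd => ?_, fun c d hcd => ?_⟩
  · exact (hpe _ _).trans (Iff.trans (by simpa using hmu.row c d hcd) (hve _ _).symm)
  · exact (hpe _ _).trans (Iff.trans (by simpa using hmu.col c d hcd) (hve _ _).symm)

/-- Positions of the grid filling: row by row. -/
def gridPos (c : ℕ × ℕ) : ℕ ×ₗ ℕ := toLex c

/-- Values of the grid filling: column by column, each one downwards. -/
def gridVal (c : ℕ × ℕ) : ℕ ×ₗ ℕᵒᵈ := toLex (c.2, OrderDual.toDual c.1)

theorem gridPos_injective : Function.Injective gridPos := toLex.injective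

theorem gridVal_injective : Function.Injective gridVal := by
  rintro ⟨i, j⟩ ⟨i', j'⟩ h
  have := toLex.injective h
  simp_all

theorem isFilling_grid (lam : YPartition) :
    IsFilling lam (fun c => gridPos c.1) (fun c => gridVal c.1) where
  row := by
    rintro ⟨⟨i, j⟩, _⟩ ⟨⟨i', j'⟩, _⟩ h
    simp_all [gridPos, gridVal, Prod.Lex.toLex_lt_toLex]
  col := by
    rintro ⟨⟨i, j⟩, _⟩ ⟨⟨i', j'⟩, _⟩ h
    simp_all [gridPos, gridVal, Prod.Lex.toLex_lt_toLex]

theorem mem_shapesOf_of_le {C : Set SPerm} (hC : IsYoungClass C) {lam mu : YPartition}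
    (hlam : lam ∈ shapesOf C) (hle : ∀ i, mu.parts i ≤ lam.parts i) : mu ∈ shapesOf C := by
  refine mem_shapesOf_of_mem_shapesOf hC hlam (isFilling_grid lam)
    (gridPos_injective.comp Subtype.val_injective) (gridVal_injective.comp Subtype.val_injective)
    (fun c => ⟨c.1, c.2.trans_le (hle _)⟩) (fun c d hcd => ?_)
    ⟨(isFilling_grid mu).row, (isFilling_grid mu).col⟩
  exact Subtype.ext (congrArg (fun x : Cell lam => x.1) hcd)

/-- The partition with `m` parts equal to `m`. -/
def squarePartition (m : ℕ) : YPartition where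
  parts i := if i < m then m else 0
  antitone i j h := by split_ifs <;> omega
  finite := ⟨m, fun i hi => if_neg (by omega)⟩

theorem mem_of_squarePartition_mem {C : Set SPerm} (hC : IsPermClass C) {m : ℕ}
    (h : squarePartition m ∈ shapesOf C) (σ : Equiv.Perm (Fin m)) : (⟨m, σ⟩ : SPerm) ∈ C := by
  refine mem_of_mem_shapesOf hC h (isFilling_grid _)
    (gridPos_injective.comp Subtype.val_injective) (gridVal_injective.comp Subtype.val_injective)
    σ (fun x => ⟨(x, σ x), by simp [squarePartition]⟩) (fun x y hxy => ?_) (fun x y => ?_)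
  · simp [gridPos, Prod.Lex.toLex_lt_toLex, hxy]
  · rcases eq_or_ne x y with rfl | hne
    · simp
    · have : (σ x : ℕ) ≠ σ y := fun he => hne (σ.injective (Fin.ext he))
      simp [gridVal, Prod.Lex.toLex_lt_toLex, this]

/-! ### Hooks -/

/-- The hook with one row of length `A + 1` and one column of length `B + 1`. -/
def hookPartition (A B : ℕ) : YPartition where
  parts i := if i = 0 then A + 1 else if i ≤ B then 1 else 0
  antitone i j h := by split_ifs <;> omega
  finite := ⟨B + 1, fun i hi => by rw [if_neg (by omega), if_neg (by omega)]⟩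

theorem exists_enumeration {α : Type*} [DecidableEq α] (X : Finset α) {z : α} (hz : z ∈ X)
    {A : ℕ} (hA : A < X.card) :
    ∃ f : ℕ → α, f 0 = z ∧ (∀ j ≤ A, f j ∈ X) ∧ ∀ i ≤ A, ∀ j ≤ A, f i = f j → i = j := by
  have hcard : Fintype.card (Fin A) ≤ Fintype.card (X.erase z) := by
    rw [Fintype.card_fin, Fintype.card_coe, Finset.card_erase_of_mem hz]
    omega
  obtain ⟨g⟩ := Function.Embedding.nonempty_of_card_le hcard
  have hne : ∀ i, (g i : α) ≠ z := fun i => Finset.ne_of_mem_erase (g i).2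
  refine ⟨fun j => if h : 0 < j ∧ j ≤ A then g ⟨j - 1, by omega⟩ else z, by simp, ?_, ?_⟩
  · intro j hj
    dsimp only
    split_ifs
    · exact Finset.mem_of_mem_erase (g _).2
    · exact hz
  · intro i hi j hj hij
    dsimp only at hij
    split_ifs at hij with h1 h2 h2
    · have := congrArg Fin.val (g.injective (Subtype.ext hij))
      simp only at this
      omega
    · exact absurd hij (hne _)
    · exact absurd hij.symm (hne _)
    · omega

theorem hookPartition_mem_shapesOf {C : Set SPerm} (hC : IsYoungClass C) {n : ℕ}
    {π : Equiv.Perm (Fin n)} (hπ : (⟨n, π⟩ : SPerm) ∈ C) {X Y : Finset (Fin n)}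
    (hX : StrictMonoOn π X) (hY : StrictAntiOn π Y) {z : Fin n} (hzX : z ∈ X) (hzY : z ∈ Y)
    {A B : ℕ} (hA : A < X.card) (hB : B < Y.card) : hookPartition A B ∈ shapesOf C := by
  obtain ⟨f, hf0, hfX, hf⟩ := exists_enumeration X hzX hA
  obtain ⟨f', hf0', hfY, hf'⟩ := exists_enumeration Y hzY hB
  have hXY : ∀ x ∈ X, x ∈ Y → x = z := by
    intro x hx hy
    rcases lt_trichotomy x z with h | h | h
    · exact absurd (hX hx hzX h) (hY hy hzY h).asymm
    · exact h
    · exact absurd (hX hzX hx h) (hY hzY hy h).asymm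
  have hne : ∀ j ≤ A, ∀ i ≤ B, f j = f' i → i = 0 := fun j hj i hi h =>
    hf' i hi 0 (Nat.zero_le _) (by rw [hf0', ← h]; exact hXY _ (hfX j hj) (h ▸ hfY i hi))
  have hcell : ∀ c : Cell (hookPartition A B),
      (c.1.1 = 0 ∧ c.1.2 ≤ A) ∨ (c.1.1 ≠ 0 ∧ c.1.1 ≤ B ∧ c.1.2 = 0) := by
    rintro ⟨⟨i, j⟩, h⟩
    simp only [hookPartition] at h ⊢
    split_ifs at h <;> omega
  refine mem_shapesOf_of_mem hC hπ
    (fun c => if c.1.1 = 0 then f c.1.2 else f' c.1.1) ?_ ⟨?_, ?_⟩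
  · rintro c d hcd
    dsimp only at hcd
    apply Subtype.ext
    rcases hcell c with ⟨h1, h2⟩ | ⟨h1, h2, h3⟩ <;> rcases hcell d with ⟨h4, h5⟩ | ⟨h4, h5, h6⟩
    · rw [if_pos h1, if_pos h4] at hcd
      exact Prod.ext (h1.trans h4.symm) (hf _ h2 _ h5 hcd)
    · rw [if_pos h1, if_neg h4] at hcd
      exact absurd (hne _ h2 _ h5 hcd) h4
    · rw [if_neg h1, if_pos h4] at hcd
      exact absurd (hne _ h5 _ h2 hcd.symm) h1
    · rw [if_neg h1, if_neg h4] at hcd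
      exact Prod.ext (hf' _ h2 _ h5 hcd) (h3.trans h6.symm)
  · intro c d hcd
    rcases hcell c with ⟨h1, h2⟩ | ⟨h1, h2, h3⟩ <;> rcases hcell d with ⟨h4, h5⟩ | ⟨h4, h5, h6⟩
    · simp only [if_pos h1, if_pos h4]
      exact (hX.lt_iff_lt (hfX _ h2) (hfX _ h5)).symm
    · omega
    · omega
    · simp [hcd, h4]
  · intro c d hcd
    have key : ∀ e : Cell (hookPartition A B), e.1.2 = 0 →
        (if e.1.1 = 0 then f e.1.2 else f' e.1.1) = f' e.1.1 ∧ e.1.1 ≤ B := by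
      intro e he
      rcases hcell e with ⟨h1, _⟩ | ⟨h1, h2, _⟩
      · simp [h1, he, hf0, hf0']
      · simp [h1, h2]
    rcases hcell c with ⟨h1, h2⟩ | ⟨h1, h2, h3⟩ <;> rcases hcell d with ⟨h4, h5⟩ | ⟨h4, h5, h6⟩
    · simp [h1, h4, hcd]
    all_goals
      obtain ⟨hc, hcB⟩ := key c (by omega)
      obtain ⟨hd, hdB⟩ := key d (by omega)
      simp only [hc, hd]
      exact (hY.lt_iff_gt (hfY _ hdB) (hfY _ hcB)).symm

theorem exists_strictMonoOn_of_le_incMax {n k : ℕ} {π : Equiv.Perm (Fin n)}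
    (h : k ≤ incMax π 1) : ∃ X : Finset (Fin n), StrictMonoOn π X ∧ k ≤ X.card := by
  obtain ⟨S, ⟨c, hc⟩, hS⟩ := Nat.sSup_mem
    (s := {m : ℕ | ∃ S : Finset (Fin n), IsUnionKIncreasing π 1 S ∧ S.card = m})
    ⟨0, ∅, ⟨fun _ => 0, by simp⟩, by simp⟩
    ⟨n, by rintro m ⟨S, -, rfl⟩; simpa using S.card_le_univ⟩
  exact ⟨S, fun x hx y hy hxy => hc x hx y hy hxy (Subsingleton.elim _ _), hS ▸ h⟩

theorem exists_strictAntiOn_of_le_decMax {n k : ℕ} {π : Equiv.Perm (Fin n)}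
    (h : k ≤ decMax π 1) : ∃ Y : Finset (Fin n), StrictAntiOn π Y ∧ k ≤ Y.card := by
  obtain ⟨S, ⟨c, hc⟩, hS⟩ := Nat.sSup_mem
    (s := {m : ℕ | ∃ S : Finset (Fin n), IsUnionKDecreasing π 1 S ∧ S.card = m})
    ⟨0, ∅, ⟨fun _ => 0, by simp⟩, by simp⟩
    ⟨n, by rintro m ⟨S, -, rfl⟩; simpa using S.card_le_univ⟩
  exact ⟨S, fun x hx y hy hxy => hc x hx y hy hxy (Subsingleton.elim _ _), hS ▸ h⟩

theorem exists_median {n k : ℕ} (X : Finset (Fin n)) (h : 2 * k + 1 ≤ X.card) :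
    ∃ x ∈ X, k < (X.filter (· ≤ x)).card ∧ k < (X.filter (x ≤ ·)).card := by
  obtain ⟨X', hX', hcard⟩ := Finset.exists_subset_card_eq h
  let e := X'.orderEmbOfFin hcard
  have he : ∀ i, e i ∈ X := fun i => hX' (X'.orderEmbOfFin_mem hcard i)
  let m : Fin (2 * k + 1) := ⟨k, by omega⟩
  refine ⟨e m, he m, ?_, ?_⟩
  · refine lt_of_lt_of_le ?_ (Finset.card_le_card_of_injOn (s := Finset.Iic m) e ?_
      e.injective.injOn)
    · simp [m]
    · intro i hi
      simpa [he] using hi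
  · refine lt_of_lt_of_le ?_ (Finset.card_le_card_of_injOn (s := Finset.Ici m) e ?_
      e.injective.injOn)
    · simp only [Fin.card_Ici, m]
      omega
    · intro i hi
      simpa [he] using hi

/-- A long increasing and a long decreasing subsequence can be made to cross at a point. -/
theorem exists_crossing {n k : ℕ} {π : Equiv.Perm (Fin n)} {X Y : Finset (Fin n)}
    (hX : StrictMonoOn π X) (hY : StrictAntiOn π Y) (hXk : 2 * k + 1 ≤ X.card)
    (hYk : 2 * k + 1 ≤ Y.card) :
    ∃ X' Y' : Finset (Fin n), ∃ z, StrictMonoOn π X' ∧ StrictAntiOn π Y' ∧ z ∈ X' ∧ z ∈ Y' ∧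
      k < X'.card ∧ k < Y'.card := by
  obtain ⟨x, hx, hlow, hup⟩ := exists_median X hXk
  by_cases hNE : ∃ y ∈ Y, x < y ∧ π x < π y
  · obtain ⟨y, hy, hxy, hπ⟩ := hNE
    refine ⟨insert y (X.filter (· ≤ x)), Y, y, ?_, hY, by simp, hy,
      hlow.trans_le (Finset.card_le_card (Finset.subset_insert _ _)), by omega⟩
    have hle : ∀ a ∈ X, a ≤ x → π a ≤ π x := fun a ha hax => hX.monotoneOn ha hx hax
    intro a ha b hb hab
    simp only [Finset.coe_insert, Finset.coe_filter, Set.mem_insert_iff, Set.mem_ofPred_eq]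
      at ha hb
    rcases ha with rfl | ⟨ha, hax⟩ <;> rcases hb with rfl | ⟨hb, hbx⟩
    · exact absurd hab (lt_irrefl _)
    · exact absurd (hab.trans_le hbx) hxy.asymm
    · exact (hle a ha hax).trans_lt hπ
    · exact hX ha hb hab
  by_cases hSW : ∃ y ∈ Y, y < x ∧ π y < π x
  · obtain ⟨y, hy, hxy, hπ⟩ := hSW
    refine ⟨insert y (X.filter (x ≤ ·)), Y, y, ?_, hY, by simp, hy,
      hup.trans_le (Finset.card_le_card (Finset.subset_insert _ _)), by omega⟩
    have hle : ∀ a ∈ X, x ≤ a → π x ≤ π a := fun a ha hax => hX.monotoneOn hx ha hax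
    intro a ha b hb hab
    simp only [Finset.coe_insert, Finset.coe_filter, Set.mem_insert_iff, Set.mem_ofPred_eq]
      at ha hb
    rcases ha with rfl | ⟨ha, hax⟩ <;> rcases hb with rfl | ⟨hb, hbx⟩
    · exact absurd hab (lt_irrefl _)
    · exact hπ.trans_le (hle b hb hbx)
    · exact absurd (hax.trans_lt hab) hxy.asymm
    · exact hX ha hb hab
  · push Not at hNE hSW
    refine ⟨X, insert x Y, x, hX, ?_, hx, by simp, by omega,
      lt_of_lt_of_le (by omega) (Finset.card_le_card (Finset.subset_insert _ _))⟩
    intro a ha b hb hab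
    simp only [Finset.coe_insert, Set.mem_insert_iff, Finset.mem_coe] at ha hb
    rcases ha with rfl | ha <;> rcases hb with rfl | hb
    · exact absurd hab (lt_irrefl _)
    · exact lt_of_le_of_ne (hNE b hb hab) fun h => hab.ne (π.injective h).symm
    · exact lt_of_le_of_ne (hSW a ha hab) fun h => hab.ne (π.injective h).symm
    · exact hY ha hb hab

/-! ### Moving two cells into one -/

/-- Positions used to pass from a diagram with rows `t` and `t + 1` of lengths `a` and `c` and
last row `L` of length `1` to the one with these lengths `a - 1`, `c + 1` and `0`. -/
def stepPos (t c a L : ℕ) (x : ℕ × ℕ) : ℕ ×ₗ ℕ :=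
  toLex (if x.1 = t + 1 ∨ x.1 = L then t else x.1,
    if x.1 = t then if x.2 = 0 then 3 else if x.2 = c then 1 else if x.2 = a - 1 then 5
      else 10 + 2 * x.2
    else if x.1 = t + 1 then if x.2 = 0 then 2 else 11 + 2 * x.2
    else if x.1 = L then 4 else x.2)

/-- The values going with `stepPos`. -/
def stepVal (t c a L : ℕ) (x : ℕ × ℕ) : ℕᵒᵈ ×ₗ ℕ :=
  toLex (OrderDual.toDual (if x.1 = t + 1 ∨ x.1 = L then t else x.1),
    if x.1 = t then if x.2 = 0 then 3 else if x.2 = c then 2 else if x.2 = a - 1 then 4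
      else 11 + 2 * x.2
    else if x.1 = t + 1 then if x.2 = 0 then 5 else 10 + 2 * x.2
    else if x.1 = L then 1 else x.2)

/-- The embedding of the new cells, omitting the old cell `(t, 0)`. -/
def stepMap (t c a L : ℕ) (x : ℕ × ℕ) : ℕ × ℕ :=
  if x.1 = t ∧ x.2 = 0 then (t, c) else if x.1 = t ∧ x.2 = c then (t + 1, 0)
  else if x.1 = t + 1 ∧ x.2 = 0 then (L, 0) else if x.1 = t + 1 ∧ x.2 = c then (t, a - 1) else x

/-- The partition obtained by removing a cell from row `t` and the last row `L`, and adding one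
to row `t + 1`. -/
def stepPartition (lam : YPartition) (t L : ℕ) (ht : lam.parts (t + 1) + 2 ≤ lam.parts t)
    (htL : t + 2 ≤ L) (hL : lam.parts (L + 1) = 0) : YPartition where
  parts i := if i = t then lam.parts t - 1 else if i = t + 1 then lam.parts (t + 1) + 1
    else if i = L then 0 else lam.parts i
  antitone i j hij := by
    have h0 := lam.antitone i j hij
    have h1 := lam.antitone i t
    have h2 := lam.antitone (t + 1) j
    have h3 := lam.antitone (L + 1) j
    split_ifs <;> grind
  finite := by
    obtain ⟨N, hN⟩ := lam.finite
    refine ⟨max N (t + 2), fun i hi => ?_⟩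
    have := hN i (by omega)
    split_ifs <;> omega

theorem stepPartition_mem_shapesOf {C : Set SPerm} (hC : IsYoungClass C) {lam : YPartition}
    (hlam : lam ∈ shapesOf C) {t L : ℕ} (ht : lam.parts (t + 1) + 2 ≤ lam.parts t)
    (ht' : 1 ≤ lam.parts (t + 1)) (htL : t + 2 ≤ L) (hL : lam.parts L = 1)
    (hL' : lam.parts (L + 1) = 0) : stepPartition lam t L ht htL hL' ∈ shapesOf C := by
  obtain ⟨a, ha⟩ : ∃ a, a = lam.parts t := ⟨_, rfl⟩
  obtain ⟨c, hc⟩ : ∃ c, c = lam.parts (t + 1) := ⟨_, rfl⟩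
  have hcell : ∀ x : Cell lam, (x.1.1 = t → x.1.2 < a) ∧ (x.1.1 = t + 1 → x.1.2 < c) ∧
      (x.1.1 = L → x.1.2 = 0) := by
    rintro ⟨⟨i, j⟩, h⟩
    grind
  have hcell' : ∀ x : Cell (stepPartition lam t L ht htL hL'), (x.1.1 = t → x.1.2 < a - 1) ∧
      (x.1.1 = t + 1 → x.1.2 < c + 1) ∧ x.1.1 ≠ L := by
    rintro ⟨⟨i, j⟩, h⟩
    simp only [stepPartition] at h
    clear hcell
    split_ifs at h <;> grind
  have hmap : ∀ x : Cell (stepPartition lam t L ht htL hL'),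
      (stepMap t c a L x.1).2 < lam.parts (stepMap t c a L x.1).1 := by
    rintro ⟨⟨i, j⟩, h⟩
    simp only [stepPartition] at h
    simp only [stepMap]
    clear hcell hcell'
    split_ifs at h <;> grind
  have hpos : ∀ x : Cell (stepPartition lam t L ht htL hL'),
      stepPos t c a L (stepMap t c a L x.1) = toLex (if x.1.1 = t + 1 then t else x.1.1,
        if x.1.1 = t then if x.1.2 = 0 then 1 else if x.1.2 = c then 2 else 10 + 2 * x.1.2
        else if x.1.1 = t + 1 then if x.1.2 = 0 then 4 else if x.1.2 = c then 5
          else 11 + 2 * x.1.2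
        else x.1.2) := by
    intro x
    have hx := hcell' x
    clear hcell hcell' hmap
    rw [stepPos, toLex_inj, Prod.mk.injEq, stepMap]
    constructor <;> grind
  have hval : ∀ x : Cell (stepPartition lam t L ht htL hL'),
      stepVal t c a L (stepMap t c a L x.1) = toLex
        (OrderDual.toDual (if x.1.1 = t + 1 then t else x.1.1),
        if x.1.1 = t then if x.1.2 = 0 then 2 else if x.1.2 = c then 5 else 11 + 2 * x.1.2
        else if x.1.1 = t + 1 then if x.1.2 = 0 then 1 else if x.1.2 = c then 4
          else 10 + 2 * x.1.2
        else x.1.2) := by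
    intro x
    have hx := hcell' x
    clear hcell hcell' hmap hpos
    rw [stepVal, toLex_inj, Prod.mk.injEq, OrderDual.toDual_inj, stepMap]
    constructor <;> grind
  refine mem_shapesOf_of_mem_shapesOf hC hlam (p := fun x => stepPos t c a L x.1)
    (v := fun x => stepVal t c a L x.1) ⟨?_, ?_⟩ ?_ ?_ (fun x => ⟨_, hmap x⟩) ?_ ⟨?_, ?_⟩
  · intro x y hxy
    have hx := hcell x
    have hy := hcell y
    clear hcell hcell' hmap
    simp only [stepPos, stepVal, Prod.Lex.toLex_lt_toLex, OrderDual.toDual_lt_toDual,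
      OrderDual.toDual_inj]
    grind
  · intro x y hxy
    have hx := hcell x
    have hy := hcell y
    clear hcell hcell' hmap
    simp only [stepPos, stepVal, Prod.Lex.toLex_lt_toLex, OrderDual.toDual_lt_toDual,
      OrderDual.toDual_inj]
    grind
  · intro x y hxy
    have hx := hcell x
    have hy := hcell y
    clear hcell hcell' hmap
    simp only [stepPos, toLex_inj, Prod.mk.injEq] at hxy
    refine Subtype.ext (Prod.ext ?_ ?_) <;> grind
  · intro x y hxy
    have hx := hcell x
    have hy := hcell y
    clear hcell hcell' hmap
    simp only [stepVal, toLex_inj, Prod.mk.injEq, OrderDual.toDual_inj] at hxy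
    refine Subtype.ext (Prod.ext ?_ ?_) <;> grind
  · intro x y hxy
    have hx := hcell' x
    have hy := hcell' y
    simp only [stepMap, Subtype.mk.injEq] at hxy
    clear hcell hcell' hpos hval
    refine Subtype.ext (Prod.ext ?_ ?_) <;> grind
  · intro x y hxy
    have hx := hcell' x
    have hy := hcell' y
    simp only [hpos, hval, Prod.Lex.toLex_lt_toLex, OrderDual.toDual_lt_toDual,
      OrderDual.toDual_inj]
    clear hcell hcell' hpos hval
    grind
  · intro x y hxy
    have hx := hcell' x
    have hy := hcell' y
    simp only [hpos, hval, Prod.Lex.toLex_lt_toLex, OrderDual.toDual_lt_toDual,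
      OrderDual.toDual_inj]
    clear hcell hcell' hpos hval
    grind

/-! ### Proper Young classes -/

theorem exists_mem_shapesOf_of_hooks {C : Set SPerm} (hC : IsYoungClass C)
    (hhook : ∀ A B, hookPartition A B ∈ shapesOf C) (t n j : ℕ) :
    ∃ lam ∈ shapesOf C, (∀ i ≤ t, n ≤ lam.parts i) ∧
      (∀ i, t < i → lam.parts i = if i ≤ t + j then 1 else 0) := by
  induction t generalizing n j with
  | zero =>
    refine ⟨_, hhook n j, fun i hi => ?_, fun i hi => ?_⟩
    · simp [hookPartition, Nat.le_zero.1 hi]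
    · simp [hookPartition, hi.ne']
  | succ t ih =>
    have hstep : ∀ m ≤ n, ∃ lam ∈ shapesOf C, (∀ i < t, 2 * n + 2 ≤ lam.parts i) ∧
        2 * n + 2 ≤ lam.parts t + m ∧ lam.parts (t + 1) = m + 1 ∧
        (∀ i, t + 1 < i → lam.parts i = if i + m ≤ t + 1 + (n + j) then 1 else 0) := by
      intro m hm
      induction m with
      | zero =>
        obtain ⟨lam, hlam, h1, h2⟩ := ih (2 * n + 2) (n + j + 1)
        refine ⟨lam, hlam, fun i hi => h1 i hi.le, h1 t le_rfl, ?_, fun i hi => ?_⟩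
        · rw [h2 _ (by omega), if_pos (by omega)]
        · rw [h2 _ (by omega)]
          congr 1
          simp only [eq_iff_iff]
          omega
      | succ m ihm =>
        obtain ⟨lam, hlam, h1, h2, h3, h4⟩ := ihm (by omega)
        have hL := h4 (t + 1 + (n + j) - m) (by omega)
        have hL' := h4 (t + 1 + (n + j) - m + 1) (by omega)
        rw [if_pos (by omega)] at hL
        rw [if_neg (by omega)] at hL'
        refine ⟨_, stepPartition_mem_shapesOf hC hlam (t := t) (by omega) (by omega)
          (by omega) hL hL', fun i hi => ?_, ?_, ?_, fun i hi => ?_⟩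
        · have := h1 i hi
          simp only [stepPartition]
          split_ifs <;> omega
        · simp only [stepPartition, if_true]
          omega
        · simp [stepPartition, h3]
        · have := h4 i hi
          simp only [stepPartition]
          split_ifs at * <;> omega
    obtain ⟨lam, hlam, h1, h2, h3, h4⟩ := hstep n le_rfl
    refine ⟨lam, hlam, fun i hi => ?_, fun i hi => ?_⟩
    · rcases Nat.lt_trichotomy i t with h | rfl | h
      · have := h1 i h
        omega
      · omega
      · obtain rfl : i = t + 1 := by omega
        omega
    · rw [h4 i hi]
      congr 1
      simp only [eq_iff_iff]
      omega

theorem proper_young_class_no_long_inc_and_dec (C : Set SPerm)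
    (hC : IsYoungClass C) (hne : C ≠ Set.univ) :
    ∃ k : ℕ, ∀ π ∈ C, ¬(k ≤ incMax π.2 1 ∧ k ≤ decMax π.2 1) := by
  by_contra! hlong
  refine hne (Set.eq_univ_of_forall ?_)
  have hhook : ∀ A B, hookPartition A B ∈ shapesOf C := by
    intro A B
    obtain ⟨⟨n, π⟩, hπ, hinc, hdec⟩ := hlong (2 * (A + B) + 1)
    obtain ⟨X, hX, hXk⟩ := exists_strictMonoOn_of_le_incMax hinc
    obtain ⟨Y, hY, hYk⟩ := exists_strictAntiOn_of_le_decMax hdec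
    obtain ⟨X', Y', z, hX', hY', hzX, hzY, hXc, hYc⟩ := exists_crossing hX hY hXk hYk
    exact hookPartition_mem_shapesOf hC hπ hX' hY' hzX hzY (by omega) (by omega)
  rintro ⟨m, σ⟩
  obtain ⟨lam, hlam, h, -⟩ := exists_mem_shapesOf_of_hooks hC hhook m m 0
  refine mem_of_squarePartition_mem hC.1 (mem_shapesOf_of_le hC hlam fun i => ?_) σ
  simp only [squarePartition]
  split_ifs with hi
  · exact h i hi.le
  · exact Nat.zero_le _
end
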